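/- arXiv:2012.07375 — 3 statements merged into one kernel-verified Lean document; each statement's English description precedes it below -/
import Mathlib

section
/- Let T be a tree with diameter at least 2. Then for any two distinct vertices u and v of T, the detour distance satisfies D(u,v) = L(u) + L(v) − 2φ(u,v) + δ(u,v). -/
open SimpleGraph Finset

namespace HCPaper

variable {V : Type*}

/-- The detour distance `D(u,v)`: the length of a longest `u`–`v` path. -/
noncomputable def detourDist (G : SimpleGraph V) (u v : V) : ℕ :=
  sSup {n | ∃ p : G.Walk u v, p.IsPath ∧ p.length = n}

/-- A hamiltonian coloring: `D(u,v) + |h u - h v| ≥ n - 1` for all distinct `u, v`. -/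
def IsHamiltonianColoring [Fintype V] (G : SimpleGraph V) (h : V → ℕ) : Prop :=
  ∀ u v : V, u ≠ v →
    Fintype.card V - 1 ≤ detourDist G u v + Nat.dist (h u) (h v)

/-- The span of a coloring: the maximum of `|h u - h v|`. -/
noncomputable def spanOf (h : V → ℕ) : ℕ :=
  sSup (Set.range fun p : V × V => Nat.dist (h p.1) (h p.2))

/-- The hamiltonian chromatic number: minimum span over hamiltonian colorings. -/
noncomputable def hc [Fintype V] (G : SimpleGraph V) : ℕ :=
  sInf {s | ∃ h : V → ℕ, IsHamiltonianColoring G h ∧ spanOf h = s}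

/-- The weight of the graph from a vertex `v`. -/
noncomputable def treeWeight [Fintype V] (G : SimpleGraph V) (v : V) : ℕ :=
  ∑ u, G.dist u v

/-- The set of weight centers. -/
def WeightCenters [Fintype V] (G : SimpleGraph V) : Set V :=
  {v | ∀ u, treeWeight G v ≤ treeWeight G u}

/-- The detour level `L(u) = min {d(u,w) : w ∈ W(T)}`. -/
noncomputable def detourLevel [Fintype V] (G : SimpleGraph V) (u : V) : ℕ :=
  sInf {k | ∃ w ∈ WeightCenters G, G.dist u w = k}

/-- The total detour level `L_W(T) = ∑ L(u)`. -/
noncomputable def totalDetourLevel [Fintype V] (G : SimpleGraph V) : ℕ :=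
  ∑ u, detourLevel G u

/-- `ζ(T)` : 0 if one weight center, 1 if two. -/
noncomputable def zeta [Fintype V] (G : SimpleGraph V) : ℕ :=
  if (WeightCenters G).ncard = 2 then 1 else 0

/-- `ζ'(T) = 1 - ζ(T)`. -/
noncomputable def zeta' [Fintype V] (G : SimpleGraph V) : ℕ := 1 - zeta G

/-- `t` is an ancestor of `v` : `t` lies on the path joining the nearest weight center and `v`. -/
def IsAncestor [Fintype V] (G : SimpleGraph V) (t v : V) : Prop :=
  ∃ w ∈ WeightCenters G, G.dist v w = detourLevel G v ∧
    ∃ p : G.Walk w v, p.IsPath ∧ t ∈ p.support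

/-- `φ(u,v)`: maximum detour level of a common ancestor of `u` and `v`. -/
noncomputable def phi [Fintype V] (G : SimpleGraph V) (u v : V) : ℕ :=
  sSup {k | ∃ t, IsAncestor G t u ∧ IsAncestor G t v ∧ detourLevel G t = k}

open Classical in
/-- `δ(u,v)`: 1 if there are two weight centers `w, w'` and the `u`–`v` path contains
the edge `ww'`, 0 otherwise. -/
noncomputable def delta [Fintype V] (G : SimpleGraph V) (u v : V) : ℕ :=
  if ∃ w w', w ≠ w' ∧ WeightCenters G = {w, w'} ∧
      ∃ p : G.Walk u v, p.IsPath ∧ s(w, w') ∈ p.edges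
  then 1 else 0

/-- `u` and `v` lie in different branches: branches at two distinct vertices adjacent to
the same weight center. -/
def InDifferentBranches [Fintype V] (G : SimpleGraph V) (u v : V) : Prop :=
  ∃ w b₁ b₂, w ∈ WeightCenters G ∧ b₁ ≠ b₂ ∧
    b₁ ∉ WeightCenters G ∧ b₂ ∉ WeightCenters G ∧
    G.Adj w b₁ ∧ G.Adj w b₂ ∧ IsAncestor G b₁ u ∧ IsAncestor G b₂ v

/-- `u` and `v` lie in opposite branches: branches at vertices adjacent to different
weight centers. -/
def InOppositeBranches [Fintype V] (G : SimpleGraph V) (u v : V) : Prop :=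
  ∃ w₁ w₂ b₁ b₂, w₁ ∈ WeightCenters G ∧ w₂ ∈ WeightCenters G ∧ w₁ ≠ w₂ ∧
    b₁ ∉ WeightCenters G ∧ b₂ ∉ WeightCenters G ∧
    G.Adj w₁ b₁ ∧ G.Adj w₂ b₂ ∧ IsAncestor G b₁ u ∧ IsAncestor G b₂ v

/-- The eccentricity of a vertex. -/
noncomputable def ecc (G : SimpleGraph V) (v : V) : ℕ :=
  sSup (Set.range fun u => G.dist v u)

/-- The center of a graph: vertices of minimum eccentricity. -/
def graphCenter (G : SimpleGraph V) : Set V :=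
  {v | ∀ u, ecc G v ≤ ecc G u}

/-- The total level with respect to the center `C(T)`. -/
noncomputable def totalLevel [Fintype V] (G : SimpleGraph V) : ℕ :=
  ∑ u, sInf {k | ∃ x ∈ graphCenter G, G.dist u x = k}

/-- `ε(T)` : 0 if the center has one vertex, 1 if two. -/
noncomputable def eps [Fintype V] (G : SimpleGraph V) : ℕ :=
  if (graphCenter G).ncard = 2 then 1 else 0

/-- `ε'(T) = 1 - ε(T)`. -/
noncomputable def eps' [Fintype V] (G : SimpleGraph V) : ℕ := 1 - eps G

/-- The weight-center based lower bound `lb_W(T)`. -/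
noncomputable def lbW [Fintype V] (G : SimpleGraph V) : ℤ :=
  ((Fintype.card V : ℤ) - 1) * ((Fintype.card V : ℤ) - 1 - zeta G) +
    zeta' G - 2 * totalDetourLevel G

/-- The center based lower bound `lb(T)`. -/
noncomputable def lbC [Fintype V] (G : SimpleGraph V) : ℤ :=
  ((Fintype.card V : ℤ) - 1) * ((Fintype.card V : ℤ) - 1 - eps G) +
    eps' G - 2 * totalLevel G

/-- The broom `B_{n,d}`: a path on vertices `0, …, d-1` together with `n - d` pendant
vertices all adjacent to the end vertex `d-1` of the path. -/
def broom (n d : ℕ) : SimpleGraph (Fin n) :=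
  SimpleGraph.fromRel (fun i j =>
    (i.val + 1 = j.val ∧ j.val < d) ∨ (i.val + 1 = d ∧ d ≤ j.val))

/-- The star `K_{1,n-1}`: vertex `0` adjacent to the `n - 1` other vertices. -/
def starGraph (n : ℕ) : SimpleGraph (Fin n) :=
  SimpleGraph.fromRel (fun i _ => i.val = 0)

/-- The caterpillar `C(m,d)`: a spine `v_1, …, v_m` with `d - 2` legs attached to each
inner spine vertex `v_2, …, v_{m-1}` (so each inner spine vertex has degree `d`). -/
def caterpillar (m d : ℕ) : SimpleGraph (Fin m ⊕ Fin (m - 2) × Fin (d - 2)) :=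
  SimpleGraph.fromRel (fun x y =>
    (∃ i j : Fin m, x = Sum.inl i ∧ y = Sum.inl j ∧ i.val + 1 = j.val) ∨
    (∃ i : Fin m, ∃ a : Fin (m - 2), ∃ b : Fin (d - 2),
      x = Sum.inl i ∧ y = Sum.inr (a, b) ∧ i.val = a.val + 1))


/-- A concatenation of two paths meeting only at their common end is a path. -/
lemma isPath_append {G : SimpleGraph V} {a b c : V} {p : G.Walk a b} {q : G.Walk b c}
    (hp : p.IsPath) (hq : q.IsPath) (h : ∀ x ∈ p.support, x ∈ q.support → x = b) :
    (p.append q).IsPath := by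
  rw [Walk.isPath_def, Walk.support_append]
  refine List.Nodup.append hp.support_nodup (hq.support_nodup.tail) fun x hx hx' => ?_
  obtain rfl := h x hx (List.mem_of_mem_tail hx')
  have := hq.support_nodup
  rw [← q.cons_tail_support] at this
  exact (List.nodup_cons.mp this).1 hx'

lemma length_eq_dist_of_isPath {G : SimpleGraph V} (hT : G.IsTree) {a b : V} {p : G.Walk a b}
    (hp : p.IsPath) : p.length = G.dist a b := by
  obtain ⟨q, hq, hq'⟩ := hT.connected.exists_path_of_dist a b
  rw [(hT.existsUnique_path a b).unique hp hq, hq']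

lemma dist_add_dist_of_mem_support {G : SimpleGraph V} (hT : G.IsTree) {a b x : V}
    {p : G.Walk a b} (hp : p.IsPath) (hx : x ∈ p.support) :
    G.dist a x + G.dist x b = G.dist a b := by
  obtain ⟨q, r, hq, hr, rfl⟩ := hp.mem_support_iff_exists_append.mp hx
  rw [← length_eq_dist_of_isPath hT hp, ← length_eq_dist_of_isPath hT hq,
    ← length_eq_dist_of_isPath hT hr, Walk.length_append]

lemma exists_isPath_mem_support {G : SimpleGraph V} (hT : G.IsTree) {a b x : V}
    (h : G.dist a x + G.dist x b = G.dist a b) :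
    ∃ p : G.Walk a b, p.IsPath ∧ x ∈ p.support := by
  obtain ⟨q, hq⟩ := hT.connected.exists_walk_length_eq_dist a x
  obtain ⟨r, hr⟩ := hT.connected.exists_walk_length_eq_dist x b
  refine ⟨q.append r, Walk.isPath_of_length_eq_dist _ (by rw [Walk.length_append]; omega), ?_⟩
  simp [Walk.mem_support_append_iff]

/-- Every three vertices of a tree have a median. -/
lemma exists_median {G : SimpleGraph V} (hT : G.IsTree) (u a b : V) :
    ∃ m, G.dist u m + G.dist m a = G.dist u a ∧ G.dist u m + G.dist m b = G.dist u b ∧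
      G.dist a m + G.dist m b = G.dist a b := by
  classical
  obtain ⟨p, hp, -⟩ := hT.connected.exists_path_of_dist a b
  obtain ⟨m, hm, hmin⟩ := p.support.toFinset.exists_min_image (G.dist u) ⟨a, by simp⟩
  simp only [List.mem_toFinset] at hm hmin
  obtain ⟨q, r, hq, hr, rfl⟩ := hp.mem_support_iff_exists_append.mp hm
  obtain ⟨s, hs, -⟩ := hT.connected.exists_path_of_dist u m
  have key : ∀ x ∈ s.support, x ∈ (q.append r).support → x = m := fun x hx hx' => by
    have h1 := dist_add_dist_of_mem_support hT hs hx
    have h2 := hmin x hx'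
    exact hT.connected.dist_eq_zero_iff.mp (by omega)
  refine ⟨m, ?_, ?_, dist_add_dist_of_mem_support hT hp hm⟩
  · refine dist_add_dist_of_mem_support hT
      (isPath_append hs hq.reverse fun x hx hx' => key x hx ?_) (by simp)
    simp only [Walk.support_reverse, List.mem_reverse] at hx'
    exact Walk.mem_support_append_iff _ _ |>.mpr (.inl hx')
  · exact dist_add_dist_of_mem_support hT
      (isPath_append hs hr fun x hx hx' => key x hx
        (Walk.mem_support_append_iff _ _ |>.mpr (.inr hx'))) (by simp)

lemma detourDist_eq_dist {G : SimpleGraph V} (hT : G.IsTree) (u v : V) :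
    detourDist G u v = G.dist u v := by
  have : {n | ∃ p : G.Walk u v, p.IsPath ∧ p.length = n} = {G.dist u v} := by
    ext n
    constructor
    · rintro ⟨p, hp, rfl⟩
      exact length_eq_dist_of_isPath hT hp
    · rintro rfl
      exact hT.connected.exists_path_of_dist u v
  rw [detourDist, this, csSup_singleton]

/-- Distinct weight centers of a tree are adjacent. -/
lemma adj_of_mem_weightCenters [Fintype V] {G : SimpleGraph V} (hT : G.IsTree) {w w' : V}
    (hw : w ∈ WeightCenters G) (hw' : w' ∈ WeightCenters G) (hne : w ≠ w') : G.Adj w w' := by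
  by_contra hadj
  have hk := hT.connected.one_lt_dist_of_ne_of_not_adj hne hadj
  have tri := fun a b c => hT.connected.dist_triangle (u := a) (v := b) (w := c)
  have comm := fun a b => G.dist_comm (u := a) (v := b)
  obtain ⟨p, hp, hlen⟩ := hT.connected.exists_path_of_dist w w'
  have hget : ∀ i j, i ≤ j → j ≤ p.length → G.dist (p.getVert i) (p.getVert j) ≤ j - i := by
    intro i j hij
    induction j, hij using Nat.le_induction with
    | base => simp
    | succ j hij ih =>
      intro hj
      have h1 := ih (by omega)
      have h2 := dist_eq_one_iff_adj.mpr (p.adj_getVert_succ (i := j) (by omega))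
      have h3 := tri (p.getVert i) (p.getVert j) (p.getVert (j + 1))
      omega
  obtain ⟨x, hx⟩ : ∃ x, p.getVert 1 = x := ⟨_, rfl⟩
  obtain ⟨y, hy⟩ : ∃ y, p.getVert (p.length - 1) = y := ⟨_, rfl⟩
  have hwx : G.dist w x ≤ 1 := by simpa [hx] using hget 0 1 (by omega) (by omega)
  have hyw : G.dist y w' ≤ 1 := by
    have := hget (p.length - 1) p.length (by omega) le_rfl
    rw [Walk.getVert_length, hy] at this
    omega
  have hle : ∀ u, G.dist u x + G.dist u y ≤ G.dist u w + G.dist u w' := by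
    intro u
    obtain ⟨m, h1, h2, h3⟩ := exists_median hT u w w'
    obtain ⟨q, hq, hm⟩ := exists_isPath_mem_support hT h3
    obtain rfl := (hT.existsUnique_path w w').unique hp hq
    obtain ⟨i, rfl, hi⟩ := Walk.mem_support_iff_exists_getVert.mp hm
    have h4 := tri u (p.getVert i) x
    have h5 := tri u (p.getVert i) y
    rw [comm w] at h3
    have h6 : G.dist (p.getVert i) x + G.dist (p.getVert i) y ≤ p.length := by
      rw [← hx, ← hy]
      rcases Nat.eq_zero_or_pos i with rfl | hi0
      · have := hget 0 1 (by omega) (by omega)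
        have := hget 0 (p.length - 1) (by omega) (by omega)
        omega
      · rcases hi.eq_or_lt with rfl | hi'
        · have := hget 1 p.length (by omega) (by omega)
          have := hget (p.length - 1) p.length (by omega) (by omega)
          rw [comm _ (p.getVert 1), comm _ (p.getVert (p.length - 1))]
          omega
        · have := hget 1 i (by omega) (by omega)
          have := hget i (p.length - 1) (by omega) (by omega)
          rw [comm _ (p.getVert 1)]
          omega
    omega
  have hlt : G.dist x x + G.dist x y < G.dist x w + G.dist x w' := by
    have h1 := hget 1 (p.length - 1) (by omega) (by omega)
    have h2 := tri w x w'
    rw [hx, hy] at h1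
    rw [comm x w, SimpleGraph.dist_self]
    omega
  have hsum : ∑ u, (G.dist u x + G.dist u y) < ∑ u, (G.dist u w + G.dist u w') :=
    Finset.sum_lt_sum (fun u _ => hle u) ⟨x, Finset.mem_univ _, hlt⟩
  simp only [Finset.sum_add_distrib] at hsum
  have h1 := hw x
  have h2 := hw' y
  simp only [treeWeight] at h1 h2
  omega

lemma detourLevel_le [Fintype V] {G : SimpleGraph V} {u w : V} (hw : w ∈ WeightCenters G) :
    detourLevel G u ≤ G.dist u w :=
  Nat.sInf_le ⟨w, hw, rfl⟩

lemma exists_dist_eq_detourLevel [Fintype V] {G : SimpleGraph V} (u : V) :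
    ∃ w ∈ WeightCenters G, G.dist u w = detourLevel G u := by
  have : Nonempty V := ⟨u⟩
  obtain ⟨w, hw⟩ := Finite.exists_min (treeWeight G)
  exact Nat.sInf_mem (s := {k | ∃ w ∈ WeightCenters G, G.dist u w = k}) ⟨_, w, hw, rfl⟩

/-- Every weight center other than a nearest one is strictly further away. -/
lemma dist_eq_detourLevel_add_one [Fintype V] {G : SimpleGraph V} (hT : G.IsTree) {u w w' : V}
    (hw : w ∈ WeightCenters G) (hu : G.dist u w = detourLevel G u)
    (hw' : w' ∈ WeightCenters G) (hne : w ≠ w') : G.dist u w' = detourLevel G u + 1 := by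
  have h1 := detourLevel_le (u := u) hw'
  have h2 := hT.dist_eq_dist_add_one_of_adj u (adj_of_mem_weightCenters hT hw hw' hne)
  omega

lemma weightCenters_eq_pair [Fintype V] {G : SimpleGraph V} (hT : G.IsTree) {w w' : V}
    (hw : w ∈ WeightCenters G) (hw' : w' ∈ WeightCenters G) (hne : w ≠ w') :
    WeightCenters G = {w, w'} := by
  ext x
  constructor
  · intro hx
    by_contra hx'
    simp only [Set.mem_insert_iff, Set.mem_singleton_iff, not_or] at hx'
    refine hT.dist_ne_of_adj x (adj_of_mem_weightCenters hT hw hw' hne) ?_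
    rw [dist_eq_one_iff_adj.mpr (adj_of_mem_weightCenters hT hx hw hx'.1),
      dist_eq_one_iff_adj.mpr (adj_of_mem_weightCenters hT hx hw' hx'.2)]
  · rintro (rfl | rfl) <;> assumption

/-- Vertices between `u` and its nearest weight center `w` also have `w` as nearest center. -/
lemma dist_eq_detourLevel_of_between [Fintype V] {G : SimpleGraph V} (hT : G.IsTree) {u w t : V}
    (hw : w ∈ WeightCenters G) (hu : G.dist u w = detourLevel G u)
    (ht : G.dist u t + G.dist t w = G.dist u w) : G.dist t w = detourLevel G t := by
  obtain ⟨x, hx, hxt⟩ := exists_dist_eq_detourLevel (G := G) t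
  have h1 := detourLevel_le (u := t) hw
  have h2 := detourLevel_le (u := u) hx
  have h3 := hT.connected.dist_triangle (u := u) (v := t) (w := x)
  omega

lemma isAncestor_iff [Fintype V] {G : SimpleGraph V} (hT : G.IsTree) {u w t : V}
    (hw : w ∈ WeightCenters G) (hu : G.dist u w = detourLevel G u) :
    IsAncestor G t u ↔ G.dist u t + G.dist t w = G.dist u w := by
  have comm := fun a b => G.dist_comm (u := a) (v := b)
  constructor
  · rintro ⟨x, hx, hxu, p, hp, ht⟩
    have hxw : w = x := by
      by_contra hne
      have := dist_eq_detourLevel_add_one hT hw hu hx hne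
      omega
    subst hxw
    have := dist_add_dist_of_mem_support hT hp ht
    rw [comm u t, comm t w, comm u w]
    omega
  · intro h
    refine ⟨w, hw, hu, exists_isPath_mem_support hT ?_⟩
    rw [comm w t, comm t u, comm w u]
    omega

/-- The distance formula for vertices with a common nearest weight center. -/
lemma dist_add_two_mul_phi [Fintype V] {G : SimpleGraph V} (hT : G.IsTree) {u v w : V}
    (hw : w ∈ WeightCenters G) (hu : G.dist u w = detourLevel G u)
    (hv : G.dist v w = detourLevel G v) :
    G.dist u v + 2 * phi G u v = detourLevel G u + detourLevel G v := by
  have comm := fun a b => G.dist_comm (u := a) (v := b)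
  obtain ⟨m, h1, h2, h3⟩ := exists_median hT w u v
  rw [comm w m, comm w u, comm m u] at h1
  rw [comm w m, comm w v, comm m v] at h2
  rw [comm m v] at h3
  have hphi : phi G u v = G.dist m w := by
    refine IsGreatest.csSup_eq ⟨⟨m, ?_, ?_, ?_⟩, ?_⟩
    · exact (isAncestor_iff hT hw hu).mpr (by omega)
    · exact (isAncestor_iff hT hw hv).mpr (by omega)
    · exact (dist_eq_detourLevel_of_between hT hw hu (by omega)).symm
    · rintro k ⟨t, htu, htv, rfl⟩
      rw [isAncestor_iff hT hw hu] at htu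
      rw [isAncestor_iff hT hw hv] at htv
      rw [← dist_eq_detourLevel_of_between hT hw hu htu]
      have h4 := hT.connected.dist_triangle (u := u) (v := t) (w := v)
      rw [comm t v] at h4
      omega
  omega

lemma delta_eq_zero [Fintype V] {G : SimpleGraph V} (hT : G.IsTree) {u v w : V}
    (hw : w ∈ WeightCenters G) (hu : G.dist u w = detourLevel G u)
    (hv : G.dist v w = detourLevel G v) : delta G u v = 0 := by
  refine if_neg ?_
  rintro ⟨x, x', hne, hW, p, hp, he⟩
  have h1 := dist_add_dist_of_mem_support hT hp (p.fst_mem_support_of_mem_edges he)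
  have h2 := dist_add_dist_of_mem_support hT hp (p.snd_mem_support_of_mem_edges he)
  rw [G.dist_comm (v := v)] at h1 h2
  have hx : x ∈ WeightCenters G := by simp [hW]
  have hx' : x' ∈ WeightCenters G := by simp [hW]
  rw [hW] at hw
  rcases hw with rfl | rfl
  · have h3 := dist_eq_detourLevel_add_one hT hx hu hx' hne
    have h4 := dist_eq_detourLevel_add_one hT hx hv hx' hne
    omega
  · have h3 := dist_eq_detourLevel_add_one hT hx' hu hx hne.symm
    have h4 := dist_eq_detourLevel_add_one hT hx' hv hx hne.symm
    omega

/-- No vertex has two distinct nearest weight centers. -/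
lemma eq_of_dist_eq_detourLevel [Fintype V] {G : SimpleGraph V} (hT : G.IsTree) {t w w' : V}
    (hw : w ∈ WeightCenters G) (hw' : w' ∈ WeightCenters G)
    (h : G.dist t w = detourLevel G t) (h' : G.dist t w' = detourLevel G t) : w = w' := by
  by_contra hne
  have := dist_eq_detourLevel_add_one hT hw h hw' hne
  omega

lemma phi_eq_zero [Fintype V] {G : SimpleGraph V} (hT : G.IsTree) {u v w w' : V}
    (hw : w ∈ WeightCenters G) (hw' : w' ∈ WeightCenters G) (hne : w ≠ w')
    (hu : G.dist u w = detourLevel G u) (hv : G.dist v w' = detourLevel G v) :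
    phi G u v = 0 := by
  have : {k | ∃ t, IsAncestor G t u ∧ IsAncestor G t v ∧ detourLevel G t = k} = ∅ := by
    refine Set.eq_empty_of_forall_notMem ?_
    rintro k ⟨t, htu, htv, -⟩
    rw [isAncestor_iff hT hw hu] at htu
    rw [isAncestor_iff hT hw' hv] at htv
    exact hne (eq_of_dist_eq_detourLevel hT hw hw'
      (dist_eq_detourLevel_of_between hT hw hu htu)
      (dist_eq_detourLevel_of_between hT hw' hv htv))
  rw [phi, this, csSup_empty, Nat.bot_eq_zero]

/-- The path joining two vertices with distinct nearest weight centers runs through both. -/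
lemma exists_isPath_through_centers [Fintype V] {G : SimpleGraph V} (hT : G.IsTree)
    {u v w w' : V} (hw : w ∈ WeightCenters G) (hw' : w' ∈ WeightCenters G) (hne : w ≠ w')
    (hu : G.dist u w = detourLevel G u) (hv : G.dist v w' = detourLevel G v) :
    ∃ p : G.Walk u v, p.IsPath ∧ s(w, w') ∈ p.edges ∧
      p.length = detourLevel G u + detourLevel G v + 1 := by
  have comm := fun a b => G.dist_comm (u := a) (v := b)
  obtain ⟨p, hp, hpl⟩ := hT.connected.exists_path_of_dist u w
  obtain ⟨q, hq, hql⟩ := hT.connected.exists_path_of_dist w' v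
  have hnear : ∀ x ∈ q.support, G.dist x w' = detourLevel G x := fun x hx => by
    have := dist_add_dist_of_mem_support hT hq hx
    refine dist_eq_detourLevel_of_between hT hw' hv ?_
    rw [comm v x, comm x w', comm v w']
    omega
  have hadj := adj_of_mem_weightCenters hT hw hw' hne
  have hwq : w ∉ q.support := fun h => by
    have h1 := hnear w h
    have h2 := detourLevel_le (u := w) hw
    rw [SimpleGraph.dist_self] at h2
    rw [dist_eq_one_iff_adj.mpr hadj] at h1
    omega
  refine ⟨p.append (.cons hadj q), isPath_append hp (hq.cons hwq) fun x hx hx' => ?_,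
    by simp, ?_⟩
  · rw [Walk.support_cons, List.mem_cons] at hx'
    refine hx'.resolve_right fun hxq => hne (eq_of_dist_eq_detourLevel hT hw hw' ?_ (hnear x hxq))
    exact dist_eq_detourLevel_of_between hT hw hu (dist_add_dist_of_mem_support hT hp hx)
  · rw [Walk.length_append, Walk.length_cons, hpl, hql, comm w' v]
    omega

/-- For a tree of diameter at least 2, `D(u,v) = L(u) + L(v) - 2φ(u,v) + δ(u,v)`. -/
theorem stmt1 [Fintype V] {G : SimpleGraph V} (hT : G.IsTree) (hd : 2 ≤ G.diam)
    (u v : V) (huv : u ≠ v) :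
    (detourDist G u v : ℤ) =
      (detourLevel G u : ℤ) + detourLevel G v - 2 * phi G u v + delta G u v := by
  rw [detourDist_eq_dist hT]
  obtain ⟨w, hw, hu⟩ := exists_dist_eq_detourLevel (G := G) u
  obtain ⟨w', hw', hv⟩ := exists_dist_eq_detourLevel (G := G) v
  by_cases hne : w = w'
  · subst hne
    have h1 := dist_add_two_mul_phi hT hw hu hv
    rw [delta_eq_zero hT hw hu hv]
    omega
  · obtain ⟨p, hp, he, hl⟩ := exists_isPath_through_centers hT hw hw' hne hu hv
    have hdelta : delta G u v = 1 :=
      if_pos ⟨w, w', hne, weightCenters_eq_pair hT hw hw' hne, p, hp, he⟩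
    rw [phi_eq_zero hT hw hw' hne hu hv, hdelta, ← length_eq_dist_of_isPath hT hp, hl]
    push_cast
    ring

end HCPaper
end

section
/- Let k ≥ 1 be an integer. Then the hamiltonian chromatic number of the broom tree B_{2k} = B_{k(2k+1),2k} is hc(B_{2k}) = 2k(2k³ + 2k² − (11/2)k + 1) + 2 = 4k⁴ + 4k³ − 11k² + 2k + 2. -/
open SimpleGraph Finset

namespace HCPaper

variable {V : Type*}

/-- The level of a vertex of the broom: its distance to the end vertex `d - 1` of the path. -/
def broomLevel (d i : ℕ) : ℕ := if i < d then d - 1 - i else 1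

/-- The linear position of a vertex of the broom, all pendant vertices being at position `d`. -/
def broomPos (d i : ℕ) : ℕ := min i d

lemma broom_adj {n d : ℕ} {u v : Fin n} :
    (broom n d).Adj u v ↔ u ≠ v ∧
      (((u.val + 1 = v.val ∧ v.val < d) ∨ (u.val + 1 = d ∧ d ≤ v.val)) ∨
        ((v.val + 1 = u.val ∧ u.val < d) ∨ (v.val + 1 = d ∧ d ≤ u.val))) := Iff.rfl

section Parent

variable {G : SimpleGraph V} {L : V → ℕ} {par : V → V}

lemma length_add_level_of_parent_notMem
    (hadj : ∀ u v, G.Adj u v →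
      (par v = u ∧ L v = L u + 1) ∨ (par u = v ∧ L u = L v + 1))
    {w v : V} (p : G.Walk w v) (hp : p.IsPath) (hw : par w ∉ p.support) :
    p.length + L w = L v := by
  induction p with
  | nil => simp
  | @cons a b c h q ih =>
    rw [Walk.cons_isPath_iff] at hp
    rw [Walk.support_cons, List.mem_cons, not_or] at hw
    rcases hadj _ _ h with ⟨h1, h2⟩ | ⟨h1, -⟩
    · have := ih hp.1 (h1 ▸ hp.2)
      rw [Walk.length_cons]
      omega
    · exact absurd (h1 ▸ q.start_mem_support) hw.2

lemma length_le_level_add_level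
    (hadj : ∀ u v, G.Adj u v →
      (par v = u ∧ L v = L u + 1) ∨ (par u = v ∧ L u = L v + 1))
    {u v : V} (p : G.Walk u v) (hp : p.IsPath) : p.length ≤ L u + L v := by
  induction p with
  | nil => simp
  | @cons a b c h q ih =>
    rw [Walk.cons_isPath_iff] at hp
    rw [Walk.length_cons]
    rcases hadj _ _ h with ⟨h1, h2⟩ | ⟨-, h2⟩
    · have := length_add_level_of_parent_notMem hadj q hp.1 (h1 ▸ hp.2)
      omega
    · have := ih hp.1
      omega

end Parent

lemma detourDist_broom_le {n d : ℕ} (hd : 1 ≤ d) (hdn : d ≤ n) (u v : Fin n) :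
    detourDist (broom n d) u v ≤ broomLevel d u + broomLevel d v := by
  refine csSup_le' ?_
  rintro m ⟨p, hp, rfl⟩
  refine length_le_level_add_level (L := fun i : Fin n => broomLevel d i)
    (par := fun i => if h : i.val + 1 < d then ⟨i.val + 1, by omega⟩ else ⟨d - 1, by omega⟩)
    ?_ p hp
  intro a b hab
  rw [broom_adj] at hab
  simp only [broomLevel, Fin.ext_iff, ne_eq] at hab ⊢
  split_ifs <;> simp only <;> omega

lemma broom_connected {n d : ℕ} (hd : 1 ≤ d) (hdn : d ≤ n) : (broom n d).Connected := by
  have key : ∀ m (u : Fin n), broomLevel d u = m →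
      (broom n d).Reachable u ⟨d - 1, by omega⟩ := by
    intro m
    induction m with
    | zero =>
      intro u hu
      have : u = ⟨d - 1, by omega⟩ := by
        rw [Fin.ext_iff]
        simp only [broomLevel] at hu ⊢
        split_ifs at hu
        omega
      rw [this]
    | succ m ih =>
      intro u hu
      simp only [broomLevel] at hu
      split_ifs at hu with h
      · have hadj : (broom n d).Adj u ⟨u.val + 1, by omega⟩ := by
          rw [broom_adj]
          refine ⟨?_, Or.inl (Or.inl ⟨rfl, ?_⟩)⟩
          · simp [Fin.ext_iff]
          · simp only
            omega
        refine hadj.reachable.trans (ih _ ?_)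
        simp only [broomLevel]
        split_ifs <;> omega
      · refine SimpleGraph.Adj.reachable ?_
        rw [broom_adj]
        have := u.isLt
        simp only [Fin.ext_iff, ne_eq]
        omega
  have : Nonempty (Fin n) := ⟨⟨d - 1, by omega⟩⟩
  exact ⟨fun u v => (key _ u rfl).trans (key _ v rfl).symm⟩

lemma length_le_detourDist [Fintype V] {G : SimpleGraph V} {u v : V} (p : G.Walk u v)
    (hp : p.IsPath) : p.length ≤ detourDist G u v := by
  refine le_csSup ⟨Fintype.card V, ?_⟩ ⟨p, hp, rfl⟩
  rintro m ⟨q, hq, rfl⟩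
  exact hq.length_lt.le

lemma broomPos_le_add_length {n d : ℕ} {u v : Fin n} (p : (broom n d).Walk u v) :
    broomPos d v ≤ broomPos d u + p.length := by
  induction p with
  | nil => simp
  | @cons a b c h q ih =>
    rw [broom_adj] at h
    rw [Walk.length_cons]
    simp only [broomPos] at ih ⊢
    omega

lemma broomPos_le_add_detourDist {n d : ℕ} (hd : 1 ≤ d) (hdn : d ≤ n) (u v : Fin n) :
    broomPos d v ≤ broomPos d u + detourDist (broom n d) u v := by
  obtain ⟨p, hp⟩ := (broom_connected hd hdn).exists_isPath u v
  have h1 := broomPos_le_add_length p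
  have h2 := length_le_detourDist p hp
  omega

lemma two_le_detourDist_broom {n d : ℕ} (hd : 1 ≤ d) (hdn : d ≤ n) {u v : Fin n} (huv : u ≠ v)
    (hu : d ≤ u.val) (hv : d ≤ v.val) : 2 ≤ detourDist (broom n d) u v := by
  obtain ⟨p, hp⟩ := (broom_connected hd hdn).exists_isPath u v
  refine le_trans ?_ (length_le_detourDist p hp)
  by_contra! hlt
  have h0 : p.length ≠ 0 := fun h => huv (Walk.eq_of_length_eq_zero h)
  have h1 := Walk.adj_of_length_eq_one (p := p) (by omega)
  rw [broom_adj] at h1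
  omega

lemma detourDist_comm (G : SimpleGraph V) (u v : V) : detourDist G u v = detourDist G v u := by
  unfold detourDist
  congr 1
  ext m
  constructor
  all_goals
    rintro ⟨p, hp, rfl⟩
    exact ⟨p.reverse, hp.reverse, p.length_reverse⟩

lemma le_telescope (a l : ℕ → ℤ) (M : ℤ) (N : ℕ)
    (h : ∀ i < N, M - l i - l (i + 1) ≤ a (i + 1) - a i) :
    N * M - 2 * ∑ i ∈ range (N + 1), l i + l 0 + l N ≤ a N - a 0 := by
  induction N with
  | zero => simp; linarith
  | succ N ih =>
    have h1 := ih fun i hi => h i (by omega)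
    have h2 := h N (by omega)
    rw [sum_range_succ]
    push_cast
    linarith

lemma dist_le_spanOf [Finite V] (h : V → ℕ) (u v : V) : Nat.dist (h u) (h v) ≤ spanOf h :=
  le_csSup (Set.finite_range _).bddAbove ⟨(u, v), rfl⟩

lemma spanOf_le {h : V → ℕ} {X : ℕ} (hX : ∀ v, h v ≤ X) : spanOf h ≤ X := by
  refine csSup_le' ?_
  rintro _ ⟨⟨u, v⟩, rfl⟩
  have h1 := hX u
  have h2 := hX v
  simp only [Nat.dist]
  omega

/-- The lower bound for the span of a hamiltonian coloring in terms of levels `l` that dominate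
detour distances, when at most one vertex has level zero. -/
lemma le_spanOf_of_level {N : ℕ} (hN : 1 ≤ N) (G : SimpleGraph (Fin (N + 1)))
    (l : Fin (N + 1) → ℕ) (hl : ∀ u v, detourDist G u v ≤ l u + l v)
    (hl0 : ∀ u v, l u = 0 → l v = 0 → u = v) {h : Fin (N + 1) → ℕ}
    (hh : IsHamiltonianColoring G h) :
    (N : ℤ) * N - 2 * (∑ u, l u : ℕ) + 1 ≤ spanOf h := by
  set σ := Tuple.sort h
  have hmono : Monotone (h ∘ σ) := Tuple.monotone_sort h
  let s : ℕ → Fin (N + 1) := fun i => σ (Fin.ofNat (N + 1) i)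
  have hval : ∀ i ≤ N, (Fin.ofNat (N + 1) i).val = i := fun i hi =>
    Nat.mod_eq_of_lt (by omega)
  have hne : ∀ i j, i < j → j ≤ N → s i ≠ s j := by
    intro i j hij hj he
    have := congrArg Fin.val (σ.injective he)
    rw [hval i (by omega), hval j hj] at this
    omega
  have htel := le_telescope (fun i => (h (s i) : ℤ)) (fun i => (l (s i) : ℤ)) N N ?_
  · have hsum : ∑ i ∈ range (N + 1), (l (s i) : ℤ) = (∑ u, l u : ℕ) := by
      rw [sum_range, Nat.cast_sum, ← Equiv.sum_comp σ fun u => (l u : ℤ)]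
      refine sum_congr rfl fun i _ => ?_
      have : Fin.ofNat (N + 1) i.val = i := Fin.ext (hval _ (by omega))
      simp only [s, this]
    have h0 : l (s 0) ≠ 0 ∨ l (s N) ≠ 0 := by
      by_contra! hc
      exact hne 0 N (by omega) le_rfl (hl0 _ _ hc.1 hc.2)
    have hsp := dist_le_spanOf h (s 0) (s N)
    simp only [Nat.dist] at hsp
    rw [hsum] at htel
    omega
  · intro i hi
    have hc := hh (s i) (s (i + 1)) (hne i (i + 1) (by omega) (by omega))
    have hm : h (s i) ≤ h (s (i + 1)) := hmono (by
      rw [Fin.le_def, hval i (by omega), hval (i + 1) (by omega)]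
      omega)
    have hd := hl (s i) (s (i + 1))
    rw [Fintype.card_fin] at hc
    simp only [Nat.dist] at hc
    omega

lemma sum_broomLevel (d m : ℕ) :
    2 * ∑ i ∈ range (d + m), broomLevel d i = d * (d - 1) + 2 * m := by
  have h1 : ∑ i ∈ range d, broomLevel d i = ∑ i ∈ range d, i := by
    rw [← sum_range_reflect]
    refine sum_congr rfl fun i hi => ?_
    rw [mem_range] at hi
    rw [broomLevel, if_pos (by omega)]
    omega
  have h2 : ∑ i ∈ range m, broomLevel d (d + i) = m := by
    simp [broomLevel]
  rw [sum_range_add, h1, h2, mul_add, mul_comm 2 (∑ i ∈ range d, i), sum_range_id_mul_two]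

/-- An optimal hamiltonian coloring of the broom `B_{2k}` with `k = q + 1`. In increasing order,
the colored vertices are the end vertex of the path, then alternately a further path vertex and
a pendant vertex, and finally the remaining pendant vertices. -/
def broomColor (q i : ℕ) : ℕ :=
  let A := (2 * q + 3) * q
  if i < 2 * q + 1 then (2 * i + 1) * A + i ^ 2 + 1
  else if i = 2 * q + 1 then 0
  else
    let a := min (i - (2 * q + 2)) (2 * q)
    2 * (a + 1) * A + a * (a + 1) + 1 + (i - (2 * q + 2) - 2 * q) * (A + 2 * q)

lemma broomColor_path {q i : ℕ} (hi : i ≤ 2 * q) :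
    broomColor q i = (2 * i + 1) * ((2 * q + 3) * q) + i ^ 2 + 1 := by
  simp only [broomColor]
  rw [if_pos (by omega)]

lemma broomColor_center (q : ℕ) : broomColor q (2 * q + 1) = 0 := by
  simp [broomColor]

lemma broomColor_pendant_of_le {q j : ℕ} (hj : j ≤ 2 * q) :
    broomColor q (2 * q + 2 + j) = 2 * (j + 1) * ((2 * q + 3) * q) + j * (j + 1) + 1 := by
  simp only [broomColor]
  rw [if_neg (by omega), if_neg (by omega), Nat.add_sub_cancel_left, min_eq_left hj,
    Nat.sub_eq_zero_of_le hj]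
  ring

lemma broomColor_pendant_of_ge (q b : ℕ) :
    broomColor q (2 * q + 2 + (2 * q + b)) =
      2 * (2 * q + 1) * ((2 * q + 3) * q) + 2 * q * (2 * q + 1) + 1 +
        b * ((2 * q + 3) * q + 2 * q) := by
  simp only [broomColor]
  rw [if_neg (by omega), if_neg (by omega), Nat.add_sub_cancel_left, Nat.add_sub_cancel_left,
    min_eq_right (by omega)]

lemma broomColor_path_path {q i j : ℕ} (hij : i < j) (hj : j ≤ 2 * q) :
    broomColor q i + ((2 * q + 3) * q + 2 * q + 2) ≤ broomColor q j + (j - i) := by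
  have hA : 5 * q ≤ (2 * q + 3) * q := by nlinarith [Nat.le_mul_self q]
  obtain ⟨t, rfl⟩ := Nat.exists_eq_add_of_lt hij
  rw [broomColor_path (by omega), broomColor_path hj, show i + t + 1 - i = t + 1 by omega]
  generalize (2 * q + 3) * q = A at hA
  nlinarith [Nat.zero_le (t * A), Nat.zero_le (t * i), Nat.zero_le (t * t)]

lemma broomColor_center_path {q i : ℕ} (hi : i ≤ 2 * q) :
    (2 * q + 3) * q + 2 * q + 2 ≤ broomColor q i + (2 * q + 1 - i) := by
  rw [broomColor_path hi]
  have : 2 * q + 1 - i + i = 2 * q + 1 := by omega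
  generalize (2 * q + 3) * q = A
  nlinarith [Nat.zero_le (i * A), Nat.le_mul_self i]

lemma broomColor_pendant_lt {q j m : ℕ} (h : j < m) :
    broomColor q (2 * q + 2 + j) + ((2 * q + 3) * q + 2 * q) ≤
      broomColor q (2 * q + 2 + m) := by
  have hA : 5 * q ≤ (2 * q + 3) * q := by nlinarith [Nat.le_mul_self q]
  have low : ∀ i t, i + t ≤ 2 * q → broomColor q (2 * q + 2 + i) +
      t * ((2 * q + 3) * q + 2 * q) ≤ broomColor q (2 * q + 2 + (i + t)) := by
    intro i t hit
    rw [broomColor_pendant_of_le (by omega), broomColor_pendant_of_le hit]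
    generalize (2 * q + 3) * q = A at hA
    nlinarith [Nat.zero_le (t * A), Nat.zero_le (t * i), Nat.zero_le (t * t),
      Nat.mul_le_mul_left t hA]
  have step : ∀ i, broomColor q (2 * q + 2 + i) + ((2 * q + 3) * q + 2 * q) ≤
      broomColor q (2 * q + 2 + (i + 1)) := by
    intro i
    rcases Nat.lt_or_ge i (2 * q) with hi | hi
    · simpa using low i 1 (by omega)
    · obtain ⟨b, rfl⟩ := Nat.exists_eq_add_of_le hi
      rw [add_assoc (2 * q) b 1, broomColor_pendant_of_ge, broomColor_pendant_of_ge]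
      linarith
  induction m, h using Nat.le_induction with
  | base => exact step j
  | succ i _ ih => exact ih.trans ((Nat.le_add_right _ _).trans (step i))

lemma broomColor_center_pendant (q j : ℕ) :
    (2 * q + 3) * q + 2 * q + 2 ≤ broomColor q (2 * q + 2 + j) + 1 := by
  have hA : 5 * q ≤ (2 * q + 3) * q := by nlinarith [Nat.le_mul_self q]
  have h0 : (2 * q + 3) * q + 2 * q + 2 ≤ broomColor q (2 * q + 2 + 0) + 1 := by
    rw [broomColor_pendant_of_le (by omega)]
    linarith
  rcases Nat.eq_zero_or_pos j with rfl | hj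
  · exact h0
  · have := broomColor_pendant_lt (q := q) hj
    omega

lemma broomColor_path_pendant {q i j : ℕ} (hi : i ≤ 2 * q) (hij : i ≤ j) :
    broomColor q i + ((2 * q + 3) * q + 2 * q + 2) ≤
      broomColor q (2 * q + 2 + j) + (2 * q + 2 - i) := by
  have h0 : broomColor q i + ((2 * q + 3) * q + 2 * q + 2) ≤
      broomColor q (2 * q + 2 + i) + (2 * q + 2 - i) := by
    rw [broomColor_path hi, broomColor_pendant_of_le hi]
    have : 2 * q + 2 - i + i = 2 * q + 2 := by omega
    linarith
  rcases hij.eq_or_lt with rfl | hlt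
  · exact h0
  · have := broomColor_pendant_lt (q := q) hlt
    omega

lemma broomColor_pendant_path {q i j : ℕ} (hi : i ≤ 2 * q) (hij : j < i) :
    broomColor q (2 * q + 2 + j) + ((2 * q + 3) * q + 2 * q + 2) ≤
      broomColor q i + (2 * q + 2 - i) := by
  rw [broomColor_path hi, broomColor_pendant_of_le (by omega)]
  have : 2 * q + 2 - i + i = 2 * q + 2 := by omega
  obtain ⟨t, rfl⟩ := Nat.exists_eq_add_of_lt hij
  generalize (2 * q + 3) * q = A
  nlinarith [Nat.zero_le (t * A), Nat.zero_le (t * j), Nat.le_mul_self t]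

lemma isHamiltonianColoring_broomColor (q : ℕ) :
    IsHamiltonianColoring (broom ((q + 1) * (2 * (q + 1) + 1)) (2 * (q + 1)))
      (fun i => broomColor q i) := by
  have hd : 1 ≤ 2 * (q + 1) := by omega
  have hdn : 2 * (q + 1) ≤ (q + 1) * (2 * (q + 1) + 1) := by nlinarith
  have hcard : (q + 1) * (2 * (q + 1) + 1) - 1 = (2 * q + 3) * q + 2 * q + 2 :=
    Nat.sub_eq_of_eq_add (by ring)
  suffices H : ∀ u v : Fin ((q + 1) * (2 * (q + 1) + 1)), u < v →
      Fintype.card (Fin ((q + 1) * (2 * (q + 1) + 1))) - 1 ≤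
        detourDist (broom ((q + 1) * (2 * (q + 1) + 1)) (2 * (q + 1))) u v +
          Nat.dist (broomColor q u) (broomColor q v) by
    intro u v huv
    rcases lt_or_gt_of_ne huv with h | h
    · exact H u v h
    · rw [detourDist_comm, Nat.dist_comm]
      exact H v u h
  intro u v huv
  have hD := broomPos_le_add_detourDist hd hdn u v
  have hD2 := two_le_detourDist_broom hd hdn huv.ne
  rw [Fintype.card_fin, hcard]
  rw [Fin.lt_def] at huv
  generalize detourDist _ u v = D at hD hD2
  generalize u.val = i at *
  generalize v.val = j at *
  simp only [broomPos, Nat.dist] at hD ⊢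
  rcases lt_trichotomy j (2 * q + 1) with hj | rfl | hj
  · have := broomColor_path_path huv (by omega : j ≤ 2 * q)
    omega
  · have := broomColor_center_path (by omega : i ≤ 2 * q)
    rw [broomColor_center]
    omega
  · obtain ⟨b, rfl⟩ := Nat.exists_eq_add_of_le (show 2 * q + 2 ≤ j by omega)
    rcases lt_trichotomy i (2 * q + 1) with hi | rfl | hi
    · rcases Nat.lt_or_ge b i with hb | hb
      · have := broomColor_pendant_path (by omega : i ≤ 2 * q) hb
        omega
      · have := broomColor_path_pendant (by omega : i ≤ 2 * q) hb
        omega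
    · have := broomColor_center_pendant q b
      rw [broomColor_center]
      omega
    · obtain ⟨a, rfl⟩ := Nat.exists_eq_add_of_le (show 2 * q + 2 ≤ i by omega)
      have := broomColor_pendant_lt (q := q) (show a < b by omega)
      have := hD2 (by omega) (by omega)
      omega

lemma broomColor_le {q i : ℕ} (hi : i < (q + 1) * (2 * (q + 1) + 1)) :
    broomColor q i ≤ broomColor q (2 * q + 2 + (2 * q + (2 * q ^ 2 + q))) := by
  rcases lt_trichotomy i (2 * q + 1) with h | rfl | h
  · have h1 := broomColor_path_pendant (j := 2 * q + (2 * q ^ 2 + q))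
      (by omega : i ≤ 2 * q) (by omega)
    omega
  · rw [broomColor_center]
    exact Nat.zero_le _
  · obtain ⟨b, rfl⟩ := Nat.exists_eq_add_of_le (show 2 * q + 2 ≤ i by omega)
    have hb : b ≤ 2 * q + (2 * q ^ 2 + q) := by nlinarith
    rcases hb.eq_or_lt with rfl | hlt
    · rfl
    · have := broomColor_pendant_lt (q := q) hlt
      omega

/-- `hc(B_{2k}) = 2k(2k³ + 2k² - (11/2)k + 1) + 2 = 4k⁴ + 4k³ - 11k² + 2k + 2`. -/
theorem stmt9 (k : ℕ) (hk : 1 ≤ k) :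
    (hc (broom (k * (2 * k + 1)) (2 * k)) : ℤ) =
      4 * (k : ℤ) ^ 4 + 4 * (k : ℤ) ^ 3 - 11 * (k : ℤ) ^ 2 + 2 * (k : ℤ) + 2 := by
  obtain ⟨q, rfl⟩ := Nat.exists_eq_add_of_le' hk
  set X := broomColor q (2 * q + 2 + (2 * q + (2 * q ^ 2 + q))) with hX
  have hXval : (X : ℤ) = 4 * ((q + 1 : ℕ) : ℤ) ^ 4 + 4 * ((q + 1 : ℕ) : ℤ) ^ 3 -
      11 * ((q + 1 : ℕ) : ℤ) ^ 2 + 2 * ((q + 1 : ℕ) : ℤ) + 2 := by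
    rw [hX, broomColor_pendant_of_ge]
    push_cast
    ring
  rw [← hXval, Nat.cast_inj]
  have hcol := isHamiltonianColoring_broomColor q
  apply le_antisymm
  · exact le_trans (Nat.sInf_le ⟨_, hcol, rfl⟩) (spanOf_le fun v => broomColor_le v.isLt)
  · refine le_csInf ⟨_, _, hcol, rfl⟩ ?_
    rintro _ ⟨h, hh, rfl⟩
    have hd : 1 ≤ 2 * (q + 1) := by omega
    have hdn : 2 * (q + 1) ≤ (q + 1) * (2 * (q + 1) + 1) := by nlinarith
    have hsum := sum_broomLevel (2 * (q + 1)) ((q + 1) * (2 * q + 1))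
    have hsize : 2 * (q + 1) + (q + 1) * (2 * q + 1) = (q + 1) * (2 * (q + 1) + 1) := by ring
    rw [hsize] at hsum
    have hn : (q + 1) * (2 * (q + 1) + 1) = ((2 * q + 3) * q + 2 * q + 2) + 1 := by ring
    generalize (q + 1) * (2 * (q + 1) + 1) = n at h hh hdn hsum hn
    subst hn
    have key := le_spanOf_of_level (by omega) _ (fun u => broomLevel (2 * (q + 1)) u)
      (detourDist_broom_le hd hdn) ?_ hh
    · rw [Fin.sum_univ_eq_sum_range (broomLevel (2 * (q + 1)))] at key
      rw [show 2 * (q + 1) - 1 = 2 * q + 1 by omega] at hsum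
      zify at hsum ⊢
      rw [hXval]
      push_cast at key hsum ⊢
      nlinarith
    · intro u v hu hv
      rw [Fin.ext_iff]
      simp only [broomLevel] at hu hv
      split_ifs at hu hv
      omega

end HCPaper
end

section
/- Let k ≥ 1 be an integer. The broom tree B_{2k} = B_{k(2k+1),2k} has a unique weight center, namely the end vertex of the path to which the k(2k−1) pendant vertices are attached, and its total detour level is L_W(B_{2k}) = 2k(2k−1). -/
open SimpleGraph Finset

namespace HCPaper

variable {V : Type*}

/-- An integer-valued function that changes by at most one along each edge bounds the distance
from below. -/
theorem abs_sub_le_dist {G : SimpleGraph V} {u v : V} (huv : G.Reachable u v) (f : V → ℤ)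
    (hf : ∀ a b, G.Adj a b → |f a - f b| ≤ 1) : |f u - f v| ≤ G.dist u v := by
  obtain ⟨p, hp⟩ := huv.exists_walk_length_eq_dist
  rw [← hp]
  clear hp huv
  induction p with
  | nil => simp
  | cons h p ih =>
    rw [SimpleGraph.Walk.length_cons]
    push_cast
    rw [add_comm]
    exact (abs_sub_le _ _ _).trans (add_le_add (hf _ _ h) ih)

theorem broom_adj_iff {n d : ℕ} {i j : Fin n} : (broom n d).Adj i j ↔
    (i.val + 1 = j.val ∧ j.val < d) ∨ (i.val + 1 = d ∧ d ≤ j.val) ∨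
    (j.val + 1 = i.val ∧ i.val < d) ∨ (j.val + 1 = d ∧ d ≤ i.val) := by
  simp only [broom, SimpleGraph.fromRel_adj, ne_eq, Fin.ext_iff]
  omega

theorem exists_walk_broom_length_eq {n d : ℕ} {c : Fin n} (hc : c.val + 1 = d) (u : Fin n) :
    ∃ p : (broom n d).Walk u c, p.length = broomLevel d u := by
  by_cases hu : u.val < d
  · obtain ⟨m, hm⟩ : ∃ m, m = d - 1 - u.val := ⟨_, rfl⟩
    rw [broomLevel, if_pos hu, ← hm]
    induction m generalizing u with
    | zero =>
      obtain rfl : u = c := Fin.ext (by omega)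
      exact ⟨.nil, rfl⟩
    | succ m ih =>
      have hlt : u.val + 1 < n := by omega
      obtain ⟨p, hp⟩ := ih ⟨u.val + 1, hlt⟩ (by simp only; omega) (by simp only; omega)
      refine ⟨.cons (broom_adj_iff.mpr (Or.inl ⟨rfl, ?_⟩)) p, by simp [hp]⟩
      simp only
      omega
  · have h : (broom n d).Adj u c := broom_adj_iff.mpr (by omega)
    exact ⟨h.toWalk, by simp [broomLevel, hu]⟩

theorem broom_reachable {n d : ℕ} (hd : 1 ≤ d) (hn : d ≤ n) (u v : Fin n) :
    (broom n d).Reachable u v := by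
  have hc : (⟨d - 1, by omega⟩ : Fin n).val + 1 = d := by simp only; omega
  obtain ⟨p, -⟩ := exists_walk_broom_length_eq hc u
  obtain ⟨q, -⟩ := exists_walk_broom_length_eq hc v
  exact ⟨p.append q.reverse⟩

theorem abs_min_sub_min_le_broom_dist {n d : ℕ} (hd : 1 ≤ d) (hn : d ≤ n) (u v : Fin n) :
    |min (u.val : ℤ) d - min (v.val : ℤ) d| ≤ (broom n d).dist u v := by
  refine abs_sub_le_dist (broom_reachable hd hn u v) (fun a : Fin n => min (a.val : ℤ) d)
    fun a b hab => ?_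
  rw [broom_adj_iff] at hab
  rw [abs_le]
  omega

theorem broom_dist_attachment {n d : ℕ} {c : Fin n} (hc : c.val + 1 = d) (u : Fin n) :
    (broom n d).dist u c = broomLevel d u := by
  obtain ⟨p, hp⟩ := exists_walk_broom_length_eq hc u
  refine le_antisymm (hp ▸ SimpleGraph.dist_le p) ?_
  have h := abs_le.mp (abs_min_sub_min_le_broom_dist (by omega) (by omega : d ≤ n) u c)
  unfold broomLevel
  split_ifs <;> omega

theorem broomLevel_add_one_le_dist_pendant {n d : ℕ} (hd : 1 ≤ d) {w u : Fin n}
    (hw : d ≤ w.val) (huw : u ≠ w) : broomLevel d u + 1 ≤ (broom n d).dist u w := by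
  have h := abs_sub_le_dist (broom_reachable hd (by omega : d ≤ n) u w)
    (fun a : Fin n => if a = w then (0 : ℤ) else broomLevel d a + 1) fun a b hab => ?_
  · simp only [huw, if_false, if_true, sub_zero] at h
    have := le_of_abs_le h
    exact_mod_cast this
  · rw [broom_adj_iff] at hab
    simp only [broomLevel, Fin.ext_iff]
    rw [abs_le]
    split_ifs <;> omega

theorem treeWeight_attachment_lt {n d : ℕ} (hd : 2 ≤ d) (hn : 2 * d < n + 2) {c w : Fin n}
    (hc : c.val + 1 = d) (hw : w ≠ c) :
    treeWeight (broom n d) c < treeWeight (broom n d) w := by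
  have hwc : w.val ≠ c.val := fun h => hw (Fin.ext h)
  simp only [treeWeight, broom_dist_attachment hc]
  by_cases hwd : w.val < d
  · obtain ⟨m, hm⟩ : ∃ m, m + w.val + 1 = d := ⟨d - 1 - w.val, by omega⟩
    have key : ∑ u : Fin n, (broomLevel d u + if u.val < d - 1 then 0 else m) ≤
        ∑ u : Fin n, ((broom n d).dist u w + if u.val < d - 1 then m else 0) := by
      refine Finset.sum_le_sum fun u _ => ?_
      have h := abs_le.mp (abs_min_sub_min_le_broom_dist (by omega) (by omega : d ≤ n) u w)
      unfold broomLevel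
      split_ifs <;> omega
    rw [Finset.sum_add_distrib, Finset.sum_add_distrib,
      Fin.sum_univ_eq_sum_range (fun i => if i < d - 1 then 0 else m) n,
      Fin.sum_univ_eq_sum_range (fun i => if i < d - 1 then m else 0) n] at key
    obtain ⟨q, rfl⟩ : ∃ q, n = (d - 1) + q := ⟨n - (d - 1), by omega⟩
    rw [Finset.sum_range_add, Finset.sum_range_add] at key
    have h1 (a b : ℕ) : ∑ i ∈ range (d - 1), (if i < d - 1 then a else b) = (d - 1) * a := by
      rw [Finset.sum_congr rfl fun i hi => if_pos (Finset.mem_range.mp hi)]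
      simp
    simp only [h1, add_lt_iff_neg_left, not_lt_zero, if_false, Finset.sum_const, card_range,
      smul_eq_mul, mul_zero, zero_add, add_zero] at key
    have h2 : (d - 1) * m < q * m := Nat.mul_lt_mul_of_pos_right (by omega) (by omega)
    omega
  · have key : ∑ u : Fin n, (broomLevel d u + 1) ≤
        ∑ u : Fin n, ((broom n d).dist u w + if u = w then 2 else 0) := by
      refine Finset.sum_le_sum fun u _ => ?_
      split_ifs with h
      · subst h
        simp [broomLevel, hwd]
      · exact broomLevel_add_one_le_dist_pendant (by omega) (by omega) h
    simp only [Finset.sum_add_distrib, Finset.sum_ite_eq', Finset.mem_univ, if_true,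
      Finset.sum_const, card_univ, Fintype.card_fin, smul_eq_mul, mul_one] at key
    omega

theorem weightCenters_broom {n d : ℕ} (hd : 2 ≤ d) (hn : 2 * d < n + 2) {c : Fin n}
    (hc : c.val + 1 = d) : WeightCenters (broom n d) = {c} := by
  ext w
  rw [Set.mem_singleton_iff]
  constructor
  · intro h
    by_contra hw
    exact (treeWeight_attachment_lt hd hn hc hw).not_ge (h c)
  · rintro rfl u
    by_cases hu : u = w
    · rw [hu]
    · exact (treeWeight_attachment_lt hd hn hc hu).le

theorem two_mul_sum_broomLevel (d p : ℕ) :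
    2 * ∑ i ∈ range (d + p), broomLevel d i = d * (d - 1) + 2 * p := by
  have h1 : ∑ i ∈ range d, broomLevel d i = ∑ i ∈ range d, i := by
    rw [← Finset.sum_range_reflect (fun i => i) d]
    exact Finset.sum_congr rfl fun i hi => if_pos (Finset.mem_range.mp hi)
  have h2 : ∑ i ∈ range p, broomLevel d (d + i) = p := by simp [broomLevel]
  rw [Finset.sum_range_add, h1, h2, ← Finset.sum_range_id_mul_two]
  ring

theorem totalDetourLevel_broom {n d : ℕ} (hd : 2 ≤ d) (hn : 2 * d < n + 2) :
    2 * totalDetourLevel (broom n d) = d * (d - 1) + 2 * (n - d) := by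
  have hc : (⟨d - 1, by omega⟩ : Fin n).val + 1 = d := by simp only; omega
  have h (u : Fin n) : detourLevel (broom n d) u = broomLevel d u := by
    simp [detourLevel, weightCenters_broom hd hn hc, broom_dist_attachment hc]
  simp only [totalDetourLevel, h]
  rw [Fin.sum_univ_eq_sum_range (broomLevel d) n, ← two_mul_sum_broomLevel,
    Nat.add_sub_cancel' (by omega)]

/-- `B_{2k}` has the unique weight center at the attachment end of the path (vertex
`d - 1 = 2k - 1`), and `L_W(B_{2k}) = 2k(2k-1)`. -/
theorem stmt11 (k : ℕ) (hk : 1 ≤ k) :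
    (∀ w : Fin (k * (2 * k + 1)),
      w ∈ WeightCenters (broom (k * (2 * k + 1)) (2 * k)) ↔ w.val = 2 * k - 1) ∧
    totalDetourLevel (broom (k * (2 * k + 1)) (2 * k)) = 2 * k * (2 * k - 1) := by
  have hn : 2 * (2 * k) < k * (2 * k + 1) + 2 := by
    obtain ⟨j, rfl⟩ := Nat.exists_eq_add_of_le hk
    ring_nf
    nlinarith [sq_nonneg j]
  have hd : 2 ≤ 2 * k := by omega
  constructor
  · intro w
    have hc : (⟨2 * k - 1, by omega⟩ : Fin (k * (2 * k + 1))).val + 1 = 2 * k := by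
      simp only
      omega
    rw [weightCenters_broom hd hn hc, Set.mem_singleton_iff, Fin.ext_iff]
  · have h := totalDetourLevel_broom hd hn
    obtain ⟨j, rfl⟩ := Nat.exists_eq_add_of_le' hk
    have h1 : (j + 1) * (2 * (j + 1) + 1) - 2 * (j + 1) = (j + 1) * (2 * j + 1) := by
      rw [Nat.sub_eq_iff_eq_add (by nlinarith)]
      ring
    have h2 : 2 * (j + 1) - 1 = 2 * j + 1 := by omega
    rw [h1, h2] at h
    rw [h2]
    linarith

end HCPaper
end
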